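/- Let k be a field of characteristic ≠ 2, let M be a semi-simple module, and let q be a quadratic space over k with dim(q) = dim_k(M). If the u-invariant of k satisfies u(k) ≤ dim_k(M⁰), then q has an isometry with module M. -/

import Mathlib

open Polynomial

noncomputable section

variable {k : Type} [Field k]

/-- `f*(X) = f(0)⁻¹ X^{deg f} f(1/X)`. -/
def starPoly (f : k[X]) : k[X] := Polynomial.C (f.coeff 0)⁻¹ * f.reverse

/-- Type 0 : a product of powers of `X - 1` and `X + 1`. -/
def IsType0Pol (f : k[X]) : Prop := ∃ a b : ℕ, f = (X - 1 : k[X]) ^ a * (X + 1) ^ b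

/-- Type 1 : a product of (powers of) monic symmetric irreducible polynomials of even degree. -/
def IsType1Pol (f : k[X]) : Prop :=
  ∃ s : Multiset k[X],
    (∀ g ∈ s, g.Monic ∧ Irreducible g ∧ g = g.reverse ∧ Even g.natDegree) ∧ f = s.prod

/-- Type 2 : a product of polynomials `g * g*` with `g` monic irreducible, `g ≠ ±g*`. -/
def IsType2Pol (f : k[X]) : Prop :=
  ∃ s : Multiset k[X],
    (∀ g ∈ s, g.Monic ∧ Irreducible g ∧ g ≠ starPoly g ∧ g ≠ -starPoly g) ∧
    f = (s.map fun g => g * starPoly g).prod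

/-- A monic polynomial is hyperbolic if it is of the form `G·G*`; equivalently, all its
components of type 0 and 1 occur with an even exponent. -/
def IsHyperbolicPoly (f : k[X]) : Prop := ∃ g : k[X], g.Monic ∧ f = g * starPoly g

/-- Data describing a self-dual torsion `k[X]`-module which is finite dimensional over `k`:
the direct sum, over `i`, of `[k[X]/(f i ^ e i)]^(n i)`, where each `f i` is monic
irreducible, and where the collection is self-dual (stable under `f ↦ f*`). -/
structure ModuleData (k : Type) [Field k] where
  ι : Type
  [fin : Fintype ι]
  f : ι → k[X]
  e : ι → ℕ
  n : ι → ℕ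
  monic : ∀ i, (f i).Monic
  irr : ∀ i, Irreducible (f i)
  epos : ∀ i, 0 < e i
  npos : ∀ i, 0 < n i
  selfdual : ∃ σ : Equiv.Perm ι,
    ∀ i, f (σ i) = starPoly (f i) ∧ e (σ i) = e i ∧ n (σ i) = n i

attribute [instance] ModuleData.fin

namespace ModuleData

variable (D : ModuleData k)

/-- The underlying `K[X]`-module of `M ⊗_k K`, realised concretely, for an extension
`ι : k →+* K`. -/
abbrev SpaceVia {K : Type} [Field K] (ι : k →+* K) : Type :=
  (i : D.ι) → Fin (D.n i) →
    (Polynomial K ⧸ Ideal.span {((D.f i).map ι) ^ D.e i})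

/-- The dimension of `M` as a `k`-vector space. -/
def dim : ℕ := ∑ i, D.n i * (D.e i * (D.f i).natDegree)

/-- The characteristic polynomial `F_M` of `M`. -/
def charPoly : k[X] := ∏ i, D.f i ^ (D.n i * D.e i)

/-- The summand `i` is of type 0 : `f i` is `X - 1` or `X + 1`. -/
def IsIdx0 (i : D.ι) : Prop := D.f i = X - 1 ∨ D.f i = X + 1

/-- The summand `i` is of type 1 : `f i` is symmetric of even degree. -/
def IsIdx1 (i : D.ι) : Prop := D.f i = (D.f i).reverse ∧ Even (D.f i).natDegree

/-- The summand `i` is of type 2 : `f i` is not self-dual. -/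
def IsIdx2 (i : D.ι) : Prop := D.f i ≠ starPoly (D.f i)

open Classical in
/-- `dim_k M⁰`. -/
def dim0 : ℕ := ∑ i, if D.IsIdx0 i then D.n i * (D.e i * (D.f i).natDegree) else 0

open Classical in
/-- `dim_k M¹`. -/
def dim1 : ℕ := ∑ i, if D.IsIdx1 i then D.n i * (D.e i * (D.f i).natDegree) else 0

open Classical in
/-- `dim_k M²`. -/
def dim2 : ℕ := ∑ i, if D.IsIdx2 i then D.n i * (D.e i * (D.f i).natDegree) else 0

/-- `M` is semi-simple : all exponents are 1. -/
def Semisimple : Prop := ∀ i, D.e i = 1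

/-- `M̄_odd` : the direct sum of the summands `[k[X]/(f)]^n`, over those summands
`[k[X]/(f^e)]^n` of `M` with `e` odd and `f` self-dual (`f = f*`). -/
def oddBar : ModuleData k where
  ι := {i : D.ι // Odd (D.e i) ∧ D.f i = starPoly (D.f i)}
  fin := by classical exact inferInstance
  f i := D.f i.1
  e _ := 1
  n i := D.n i.1
  monic i := D.monic i.1
  irr i := D.irr i.1
  epos _ := one_pos
  npos i := D.npos i.1
  selfdual := ⟨Equiv.refl _, fun i => ⟨i.2.2, rfl, rfl⟩⟩

end ModuleData

theorem starPoly_eq_self_of_symm {f : k[X]} (hm : f.Monic) (hs : f = f.reverse) :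
    starPoly f = f := by
  have h0 : f.coeff 0 = 1 := by
    conv_lhs => rw [hs]
    rw [Polynomial.coeff_zero_reverse]
    exact hm
  rw [starPoly, h0, inv_one, map_one, one_mul, ← hs]

/-- The module `[k[X]/(f)]^m` for a monic symmetric irreducible `f`. -/
def ModuleData.single (f : k[X]) (hmon : f.Monic) (hirr : Irreducible f)
    (hsym : f = f.reverse) (m : ℕ) (hm : 0 < m) : ModuleData k where
  ι := Unit
  fin := inferInstance
  f _ := f
  e _ := 1
  n _ := m
  monic _ := hmon
  irr _ := hirr
  epos _ := one_pos
  npos _ := hm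
  selfdual := ⟨Equiv.refl _, fun _ => ⟨(starPoly_eq_self_of_symm hmon hsym).symm, rfl, rfl⟩⟩

section Bilin

variable {V : Type} [AddCommGroup V] [Module k V]

/-- `t` is an isometry of the bilinear space `(V, B)`. -/
def IsIsometryOf (B : LinearMap.BilinForm k V) (t : V ≃ₗ[k] V) : Prop :=
  ∀ x y, B (t x) (t y) = B x y

/-- `(V, B)` is a quadratic space : `B` is a symmetric bilinear form of non-zero
determinant (equivalently, non-degenerate). -/
def IsQuadraticSpace (B : LinearMap.BilinForm k V) : Prop :=
  (∀ x y, B x y = B y x) ∧ (∀ x, (∀ y, B x y = 0) → x = 0)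

/-- The bilinear space `(W, B)` over an extension `ι : k →+* K` has an isometry whose
associated `K[X]`-module is `M ⊗_k K`. -/
def HasIsometryWithModuleVia {K : Type} [Field K] (ι : k →+* K)
    {W : Type} [AddCommGroup W] [Module K W]
    (B : LinearMap.BilinForm K W) (D : ModuleData k) : Prop :=
  ∃ t : W ≃ₗ[K] W, IsIsometryOf B t ∧
    ∃ φ : W ≃ₗ[K] D.SpaceVia ι, ∀ w, φ (t w) = (X : Polynomial K) • φ w

/-- `(V, B)` has an isometry with module `M`. -/
def HasIsometryWithModule (B : LinearMap.BilinForm k V) (D : ModuleData k) : Prop :=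
  HasIsometryWithModuleVia (RingHom.id k) B D

/-- The bilinear space `(W, B)` over an extension `ι : k →+* K` has an isometry with
minimal polynomial (the image of) `f`. -/
def HasIsometryWithMinpolyVia {K : Type} [Field K] (ι : k →+* K)
    {W : Type} [AddCommGroup W] [Module K W]
    (B : LinearMap.BilinForm K W) (f : k[X]) : Prop :=
  ∃ t : W ≃ₗ[K] W, IsIsometryOf B t ∧ minpoly K t.toLinearMap = f.map ι

/-- `(V, B)` has an isometry with minimal polynomial `f`. -/
def HasIsometryWithMinpoly (B : LinearMap.BilinForm k V) (f : k[X]) : Prop :=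
  ∃ t : V ≃ₗ[k] V, IsIsometryOf B t ∧ minpoly k t.toLinearMap = f

/-- A (2n)-dimensional quadratic space is hyperbolic if it has a self-orthogonal subspace
of dimension n. -/
def IsHyperbolicSpace (B : LinearMap.BilinForm k V) : Prop :=
  ∃ W : Submodule k V, (∀ x ∈ W, ∀ y ∈ W, B x y = 0) ∧
    2 * Module.finrank k W = Module.finrank k V

/-- The Witt index : the largest dimension of a totally isotropic subspace. -/
def wittIndex (B : LinearMap.BilinForm k V) : ℕ :=
  sSup {m | ∃ W : Submodule k V, (∀ x ∈ W, ∀ y ∈ W, B x y = 0) ∧ Module.finrank k W = m}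

variable [FiniteDimensional k V]

/-- The Gram matrix of `B` with respect to a fixed basis. -/
def gramOf (B : LinearMap.BilinForm k V) :
    Matrix (Fin (Module.finrank k V)) (Fin (Module.finrank k V)) k :=
  LinearMap.toMatrix₂ (Module.finBasis k V) (Module.finBasis k V) B

/-- The determinant of `B` (well defined modulo nonzero squares). -/
def detOf (B : LinearMap.BilinForm k V) : k := (gramOf B).det

end Bilin

section QuadraticSpaces

variable {V : Type} [AddCommGroup V] [Module k V]

/-- An isotropic quadratic space over a field of characteristic `≠ 2` is universal. -/
theorem IsQuadraticSpace.exists_apply_self_eq (hchar : (2 : k) ≠ 0)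
    {B : LinearMap.BilinForm k V} (hq : IsQuadraticSpace B)
    {w : V} (hw : B w w = 0) (hw0 : w ≠ 0) (a : k) : ∃ v, B v v = a := by
  obtain ⟨z, hz⟩ : ∃ z, B w z ≠ 0 := by
    by_contra! h
    exact hw0 (hq.2 w h)
  refine ⟨z + ((a - B z z) / (2 * B w z)) • w, ?_⟩
  simp only [map_add, map_smul, LinearMap.add_apply, LinearMap.smul_apply, smul_eq_mul, hw,
    hq.1 z w]
  field_simp
  ring

/-- The orthogonal complement of an anisotropic vector of a quadratic space is again a
quadratic space. -/
theorem IsQuadraticSpace.restrict_ker {B : LinearMap.BilinForm k V} (hq : IsQuadraticSpace B)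
    {v : V} (hv : B v v ≠ 0) : IsQuadraticSpace (B.restrict (LinearMap.ker (B v))) := by
  refine ⟨fun x y => hq.1 x y, fun x hx => Subtype.ext (hq.2 x fun y => ?_)⟩
  have hxv : B x v = 0 := (hq.1 _ _).trans x.2
  have hy : y - (B v y / B v v) • v ∈ LinearMap.ker (B v) := by
    simp [LinearMap.mem_ker, hv]
  simpa [hxv] using hx ⟨_, hy⟩

variable [FiniteDimensional k V]

theorem finrank_ker_apply_add_one {B : LinearMap.BilinForm k V} {v : V} (hv : B v v ≠ 0) :
    Module.finrank k (LinearMap.ker (B v)) + 1 = Module.finrank k V :=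
  Module.Dual.finrank_ker_add_one_of_ne_zero fun h => hv (by simp [h])

theorem IsQuadraticSpace.exists_orthogonal_basis (hchar : (2 : k) ≠ 0)
    {B : LinearMap.BilinForm k V} (hq : IsQuadraticSpace B) {I : Type} [Fintype I]
    (hI : Module.finrank k V = Fintype.card I) :
    ∃ v : Module.Basis I k V, B.IsOrthoᵢ v ∧ ∀ i, B (v i) (v i) ≠ 0 := by
  have := invertibleOfNonzero hchar
  obtain ⟨v, hv⟩ := LinearMap.BilinForm.exists_orthogonal_basis (B := B) ⟨hq.1⟩
  have hv0 : ∀ i, B (v i) (v i) ≠ 0 := fun i hi => v.ne_zero i <| hq.2 _ fun y => by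
    have : B (v i) = 0 := v.ext fun j => by
      rcases eq_or_ne i j with rfl | hij
      · simpa using hi
      · simpa using hv hij
    simp [this]
  let e : Fin (Module.finrank k V) ≃ I := (Fintype.equivFinOfCardEq hI.symm).symm
  refine ⟨v.reindex e, fun i j hij => ?_, fun i => ?_⟩
  · simpa [Function.onFun] using hv (e.symm.injective.ne hij)
  · simpa using hv0 (e.symm i)

/-- Over a field over which every quadratic form of dimension `> d` is isotropic, a quadratic
space of dimension `d + m` contains every diagonal quadratic space of dimension `m`. -/
theorem IsQuadraticSpace.exists_orthogonal_family (hchar : (2 : k) ≠ 0) {I : Type} [Fintype I]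
    (hu : ∀ (W : Type) [AddCommGroup W] [Module k W] [FiniteDimensional k W]
      (B' : LinearMap.BilinForm k W), (∀ x y, B' x y = B' y x) →
      (∀ w, B' w w = 0 → w = 0) → Module.finrank k W ≤ Fintype.card I)
    {m : ℕ} (a : Fin m → k) (ha : ∀ i, a i ≠ 0)
    {B : LinearMap.BilinForm k V} (hq : IsQuadraticSpace B)
    (hV : Module.finrank k V = Fintype.card I + m) :
    ∃ (w : I → V) (v : Fin m → V), B.IsOrthoᵢ (Sum.elim w v) ∧
      (∀ i, B (w i) (w i) ≠ 0) ∧ ∀ i, B (v i) (v i) = a i := by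
  induction m generalizing V with
  | zero =>
    obtain ⟨w, hw, hw0⟩ := hq.exists_orthogonal_basis hchar hV
    refine ⟨w, Fin.elim0, ?_, hw0, fun i => i.elim0⟩
    rintro (i | i) (j | j) hij
    · exact hw (i := i) (j := j) fun h => hij (by rw [h])
    all_goals exact Fin.elim0 ‹_›
  | succ m ih =>
    obtain ⟨x, hx, hx0⟩ : ∃ x, B x x = 0 ∧ x ≠ 0 := by
      by_contra! h
      have := hu V B hq.1 h
      omega
    obtain ⟨u, hu'⟩ := hq.exists_apply_self_eq hchar hx hx0 (a 0)
    have hu0 : B u u ≠ 0 := hu' ▸ ha 0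
    obtain ⟨w, v, h, hw, hv⟩ := ih (fun i => a i.succ) (fun i => ha _) (hq.restrict_ker hu0)
      (by have := finrank_ker_apply_add_one hu0; omega)
    have hl (z : LinearMap.ker (B u)) : B u z = 0 := z.2
    have hr (z : LinearMap.ker (B u)) : B z u = 0 := (hq.1 _ _).trans z.2
    refine ⟨fun i => w i, Fin.cons u fun i => v i, ?_, hw, Fin.cases (by simpa using hu') hv⟩
    rintro (i | i) (j | j) hij
    · exact h (i := Sum.inl i) (j := Sum.inl j) fun e => hij (by simp_all)
    · cases j using Fin.cases with
      | zero => exact hr _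
      | succ j => exact h (i := Sum.inl i) (j := Sum.inr j) Sum.inl_ne_inr
    · cases i using Fin.cases with
      | zero => exact hl _
      | succ i => exact h (i := Sum.inr i) (j := Sum.inl j) Sum.inr_ne_inl
    · cases i using Fin.cases with
      | zero =>
        cases j using Fin.cases with
        | zero => exact absurd rfl hij
        | succ j => exact hl _
      | succ i =>
        cases j using Fin.cases with
        | zero => exact hr _
        | succ j => exact h (i := Sum.inr i) (j := Sum.inr j) fun e => hij (by simp_all)

end QuadraticSpaces

section InvariantForms

open AdjoinRoot

/-- A family of simple `k[X]`-modules permuted by an involution compatible with `X ↦ X⁻¹`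
carries a quadratic space structure for which multiplication by `X` is an isometry. -/
theorem exists_isQuadraticSpace_pi_adjoinRoot (hchar : (2 : k) ≠ 0) {J : Type} [Fintype J]
    (g : J → k[X]) [∀ j, Fact (Irreducible (g j))] (hroot : ∀ j, root (g j) ≠ 0)
    {τ : J → J} (hτ : Function.Involutive τ)
    (hg : ∀ j, (g (τ j)).eval₂ (algebraMap k (AdjoinRoot (g j))) (root (g j))⁻¹ = 0) :
    ∃ b : LinearMap.BilinForm k (∀ j, AdjoinRoot (g j)), IsQuadraticSpace b ∧
      ∀ x y, b (fun j => root (g j) * x j) (fun j => root (g j) * y j) = b x y := by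
  classical
  let bar (j : J) : AdjoinRoot (g (τ j)) →ₐ[k] AdjoinRoot (g j) :=
    liftAlgHom _ (Algebra.ofId _ _) _ (hg j)
  have bar_root (j : J) : bar j (root _) = (root (g j))⁻¹ := liftAlgHom_root ..
  have bar_bar (x : ∀ j, AdjoinRoot (g j)) (j : J) : bar j (bar (τ j) (x (τ (τ j)))) = x j := by
    have key (i : J) (hi : i = j) (φ : AdjoinRoot (g i) →ₐ[k] AdjoinRoot (g j))
        (hφ : φ (root (g i)) = root (g j)) : φ (x i) = x j := by
      subst hi
      have : φ = AlgHom.id k _ := AdjoinRoot.algHom_ext hφ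
      simp [this]
    exact key _ (hτ j) ((bar j).comp (bar (τ j))) (by simp [bar_root])
  have hl (j : J) : ∃ l : AdjoinRoot (g j) →ₗ[k] k, l 1 = 1 := by
    obtain ⟨l, hl⟩ := LinearMap.exists_leftInverse_of_injective
      (Algebra.linearMap k (AdjoinRoot (g j)))
      (LinearMap.ker_eq_bot.2 (algebraMap k (AdjoinRoot (g j))).injective)
    exact ⟨l, by simpa using LinearMap.congr_fun hl 1⟩
  choose l hl using hl
  let c : LinearMap.BilinForm k (∀ j, AdjoinRoot (g j)) := ∑ j,
    ((LinearMap.mul k (AdjoinRoot (g j))).compl₁₂ (LinearMap.proj j)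
      ((bar j).toLinearMap ∘ₗ LinearMap.proj (τ j))).compr₂ (l j)
  have hc (x y) : c x y = ∑ j, l j (x j * bar j (y (τ j))) := by
    simp [c, LinearMap.sum_apply]
  have hX (x y : ∀ j, AdjoinRoot (g j)) :
      c (fun j => root (g j) * x j) (fun j => root (g j) * y j) = c x y := by
    simp only [hc, map_mul, bar_root]
    refine Finset.sum_congr rfl fun j _ => congrArg (l j) ?_
    have := hroot j
    field_simp
  refine ⟨c + c.flip, ⟨fun x y => ?_, fun x hx => ?_⟩, fun x y => ?_⟩
  · simp [add_comm]
  · by_contra hx0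
    obtain ⟨i, hi⟩ := Function.ne_iff.1 hx0
    have hbar : bar (τ i) (x (τ (τ i))) ≠ 0 := fun h => hi (by
      have := bar_bar x i
      rw [h, map_zero] at this
      simpa using this.symm)
    have h := hx (Pi.single (τ i) (bar (τ i) (x (τ (τ i))))⁻¹)
    have h1 : c x (Pi.single (τ i) (bar (τ i) (x (τ (τ i))))⁻¹) = 1 := by
      rw [hc, Finset.sum_eq_single i]
      · rw [Pi.single_eq_same, map_inv₀, bar_bar, mul_inv_cancel₀ hi, hl]
      · intro j _ hj
        rw [Pi.single_eq_of_ne (hτ.injective.ne hj)]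
        simp
      · simp
    have h2 : c (Pi.single (τ i) (bar (τ i) (x (τ (τ i))))⁻¹) x = 1 := by
      rw [hc, Finset.sum_eq_single (τ i)]
      · rw [Pi.single_eq_same, inv_mul_cancel₀ hbar, hl]
      · intro j _ hj
        rw [Pi.single_eq_of_ne hj]
        simp
      · simp
    refine hchar ?_
    calc (2 : k) = c x _ + c _ x := by rw [h1, h2, one_add_one_eq_two]
      _ = 0 := h
  · simp [hX]

end InvariantForms

section StarPoly

theorem starPoly_starPoly {g : k[X]} (hg : g.Monic) (h0 : g.coeff 0 ≠ 0) :
    starPoly (starPoly g) = g := by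
  have h1 : (starPoly g).coeff 0 = (g.coeff 0)⁻¹ := by
    simp [starPoly, hg.leadingCoeff]
  have h2 : g.reverse.reverse = g := by
    have hd : g.reverse.natDegree = g.natDegree := by
      rw [reverse_natDegree, natTrailingDegree_eq_zero.2 (Or.inr h0), Nat.sub_zero]
    rw [Polynomial.reverse, hd, Polynomial.reverse, reflect_reflect]
  rw [starPoly, h1, starPoly, reverse_mul_of_domain, reverse_C, h2, inv_inv, ← mul_assoc, ← C_mul,
    mul_inv_cancel₀ h0, C_1, one_mul]

theorem eval₂_starPoly_inv {L : Type} [Field L] (i : k →+* L) {g : k[X]} {x : L} (hx : x ≠ 0)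
    (h : g.eval₂ i x = 0) : (starPoly g).eval₂ i x⁻¹ = 0 := by
  have := invertibleOfNonzero hx
  rw [starPoly, eval₂_mul, ← invOf_eq_inv, (eval₂_reverse_eq_zero_iff i x g).2 h, mul_zero]

end StarPoly

section SemisimpleModules

open AdjoinRoot

theorem finrank_pi_adjoinRoot {J : Type} [Fintype J] (g : J → k[X]) (hg : ∀ j, g j ≠ 0) :
    Module.finrank k (∀ j, AdjoinRoot (g j)) = ∑ j, (g j).natDegree := by
  have (j : J) : Module.Finite k (AdjoinRoot (g j)) := (powerBasis (hg j)).finite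
  rw [Module.finrank_pi_fintype]
  exact Finset.sum_congr rfl fun j _ => by
    rw [(powerBasis (hg j)).finrank, powerBasis_dim]

/-- The case of a module given as a direct sum of simple modules that is indexed by a type with
an involution matching each summand with its dual. -/
theorem exists_isometry_pi_adjoinRoot (hchar : (2 : k) ≠ 0) {J : Type} [Fintype J]
    (g : J → k[X]) (hirr : ∀ j, Irreducible (g j))
    (h0 : ∀ j, (g j).coeff 0 ≠ 0) {τ : J → J} (hτ : Function.Involutive τ)
    (hg : ∀ j, g (τ j) = starPoly (g j))
    (hτ0 : ∀ j, g j = X - 1 ∨ g j = X + 1 → τ j = j)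
    [Fintype {j // g j = X - 1 ∨ g j = X + 1}]
    (hu : ∀ (W : Type) [AddCommGroup W] [Module k W] [FiniteDimensional k W]
      (B' : LinearMap.BilinForm k W), (∀ x y, B' x y = B' y x) →
      (∀ w, B' w w = 0 → w = 0) →
        Module.finrank k W ≤ Fintype.card {j // g j = X - 1 ∨ g j = X + 1})
    {V : Type} [AddCommGroup V] [Module k V] [FiniteDimensional k V]
    {B : LinearMap.BilinForm k V} (hq : IsQuadraticSpace B)
    (hdim : Module.finrank k V = ∑ j, (g j).natDegree) :
    ∃ t : V ≃ₗ[k] V, IsIsometryOf B t ∧ ∃ φ : V ≃ₗ[k] (∀ j, AdjoinRoot (g j)),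
      ∀ w j, φ (t w) j = root (g j) * φ w j := by
  classical
  have hfact (j : J) : Fact (Irreducible (g j)) := ⟨hirr j⟩
  have hfin (j : J) : Module.Finite k (AdjoinRoot (g j)) := (powerBasis (hirr j).ne_zero).finite
  have hroot (j : J) : root (g j) ≠ 0 := fun h => h0 j <| by
    have := eval₂_root (g j)
    rw [h, eval₂_at_zero] at this
    exact (map_eq_zero _).1 this
  let J₀ := {j // g j = X - 1 ∨ g j = X + 1}
  let J₁ := {j // ¬ (g j = X - 1 ∨ g j = X + 1)}
  have hτ₁ (j : J₁) : ¬ (g (τ j) = X - 1 ∨ g (τ j) = X + 1) := fun h =>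
    j.2 <| by rwa [← hτ j, hτ0 _ h]
  obtain ⟨b, hb, hbX⟩ := exists_isQuadraticSpace_pi_adjoinRoot hchar (fun j : J₁ => g j)
    (fun j => hroot j) (τ := fun j => ⟨τ j, hτ₁ j⟩) (fun j => Subtype.ext (hτ j))
    (fun j => by
      simp only [hg]
      exact eval₂_starPoly_inv _ (hroot _) (eval₂_root _))
  obtain ⟨e, he, he0⟩ := hb.exists_orthogonal_basis hchar (Fintype.card_fin _).symm
  have hdim' : Module.finrank k V =
      Fintype.card J₀ + Module.finrank k (∀ j : J₁, AdjoinRoot (g j)) := by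
    rw [hdim, finrank_pi_adjoinRoot _ fun j : J₁ => (hirr j).ne_zero,
      ← Fintype.sum_subtype_add_sum_subtype (fun j => g j = X - 1 ∨ g j = X + 1),
      Fintype.card_eq_sum_ones]
    congr 1
    refine Finset.sum_congr (congrArg (@Finset.univ _) (Subsingleton.elim _ _)) fun j _ => ?_
    obtain h | h := j.2 <;> rw [h]
    · exact natDegree_X_sub_C 1
    · exact natDegree_X_add_C 1
  obtain ⟨w, v, hwv, hw, hv⟩ := hq.exists_orthogonal_family hchar hu _ he0 hdim'
  have hli : LinearIndependent k (Sum.elim w v) :=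
    LinearMap.linearIndependent_of_isOrthoᵢ hwv (by
      rintro (i | i)
      · exact hw i
      · exact (hv i).trans_ne (he0 i))
  let bV := basisOfLinearIndependentOfCardEqFinrank' _ hli (by simp [hdim', J₀])
  let bN := (Pi.basisFun k J₀).prod e
  let φ₀ := bN.equiv bV (Equiv.refl _)
  let c : LinearMap.BilinForm k ((J₀ → k) × ∀ j : J₁, AdjoinRoot (g j)) :=
    (∑ j : J₀, B (w j) (w j) • (LinearMap.mul k k).compl₁₂
      (LinearMap.proj j ∘ₗ LinearMap.fst k (J₀ → k) (∀ j : J₁, AdjoinRoot (g j)))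
      (LinearMap.proj j ∘ₗ LinearMap.fst k (J₀ → k) (∀ j : J₁, AdjoinRoot (g j)))) +
    b.compl₁₂ (LinearMap.snd k _ _) (LinearMap.snd k _ _)
  have hc (x y) : c x y = ∑ j : J₀, B (w j) (w j) * (x.1 j * y.1 j) + b x.2 y.2 := by
    simp [c, LinearMap.sum_apply]
  have hφ₀ (x y) : B (φ₀ x) (φ₀ y) = c x y := by
    have : B.compl₁₂ φ₀.toLinearMap φ₀.toLinearMap = c := by
      refine LinearMap.ext_basis bN bN fun i j => ?_
      have hL : B.compl₁₂ φ₀.toLinearMap φ₀.toLinearMap (bN i) (bN j) =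
          B (Sum.elim w v i) (Sum.elim w v j) := by
        simp [φ₀, bV]
      rw [hL, hc]
      rcases eq_or_ne i j with rfl | hij
      · rcases i with i | i
        · rw [Finset.sum_eq_single i (fun j _ hj => by simp [bN, hj]) (by simp)]
          simp [bN]
        · simp [bN, hv]
      · have h1 : B (Sum.elim w v i) (Sum.elim w v j) = 0 := hwv hij
        rw [h1]
        rcases i with i | i <;> rcases j with j | j
        · have : i ≠ j := fun h => hij (by rw [h])
          rw [Finset.sum_eq_zero fun l _ => ?_]
          · simp [bN]
          · obtain rfl | h := eq_or_ne l i <;> simp [bN, *]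
        · simp [bN]
        · simp [bN]
        · have h2 : b (e i) (e j) = 0 := he fun h => hij (by rw [h])
          simp [bN, h2]
    exact LinearMap.congr_fun₂ this x y
  have hκ (j : J₀) : ∃ (κ : AdjoinRoot (g j) →ₐ[k] k) (r : k), r * r = 1 ∧ κ (root _) = r := by
    obtain ⟨r, hr, hgr⟩ : ∃ r : k, r * r = 1 ∧ (g j).eval r = 0 := by
      obtain h | h := j.2
      · exact ⟨1, by simp, by simp [h]⟩
      · exact ⟨-1, by simp, by simp [h]⟩
    exact ⟨liftAlgHom _ (AlgHom.id k k) r hgr, r, hr, liftAlgHom_root ..⟩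
  choose κ r hr hκ using hκ
  let Ψ : (∀ j, AdjoinRoot (g j)) →ₗ[k] (J₀ → k) × ∀ j : J₁, AdjoinRoot (g j) :=
    (LinearMap.pi fun j => (κ j).toLinearMap ∘ₗ LinearMap.proj j.1).prod
      (LinearMap.pi fun j => LinearMap.proj j.1)
  have hΨ : Function.Injective Ψ := by
    rw [← LinearMap.ker_eq_bot, LinearMap.ker_eq_bot']
    intro z hz
    funext j
    by_cases hj : g j = X - 1 ∨ g j = X + 1
    · exact (map_eq_zero (κ ⟨j, hj⟩)).1 (congrFun (congrArg Prod.fst hz) ⟨j, hj⟩)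
    · exact congrFun (congrArg Prod.snd hz) ⟨j, hj⟩
  let Φ := (LinearMap.linearEquivOfInjective Ψ hΨ (by
    rw [finrank_pi_adjoinRoot g fun j => (hirr j).ne_zero, ← hdim, φ₀.finrank_eq])).trans φ₀
  have hΦ (x y) : B (Φ x) (Φ y) = c (Ψ x) (Ψ y) := hφ₀ _ _
  let μ : (∀ j, AdjoinRoot (g j)) →ₗ[k] ∀ j, AdjoinRoot (g j) :=
    LinearMap.pi fun j => LinearMap.mulLeft k (root (g j)) ∘ₗ LinearMap.proj j
  have hμ : Function.Injective μ := fun x y hxy => funext fun j =>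
    mul_left_cancel₀ (hroot j) (congrFun hxy j)
  have hΦμ (x y) : B (Φ (μ x)) (Φ (μ y)) = B (Φ x) (Φ y) := by
    rw [hΦ, hΦ, hc, hc]
    refine congrArg₂ _ (Finset.sum_congr rfl fun j _ => congrArg _ ?_) (hbX (Ψ x).2 (Ψ y).2)
    change κ j (root _ * x j) * κ j (root _ * y j) = κ j (x j) * κ j (y j)
    rw [map_mul, map_mul, hκ, mul_mul_mul_comm, hr, one_mul]
  refine ⟨(Φ.symm.trans (LinearEquiv.ofInjectiveEndo μ hμ)).trans Φ, fun x y => ?_, Φ.symm,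
    fun x j => ?_⟩
  · simpa using hΦμ (Φ.symm x) (Φ.symm y)
  · simp [μ]

end SemisimpleModules

theorem exists_linearEquiv_piSigma {ι : Type} (n : ι → ℕ) {M N : ι → Type}
    [∀ i, AddCommMonoid (M i)] [∀ i, Module k (M i)] [∀ i, AddCommMonoid (N i)]
    [∀ i, Module k (N i)] (E : ∀ i, M i ≃ₗ[k] N i) :
    ∃ Φ : (∀ j : Σ i, Fin (n i), M j.1) ≃ₗ[k] ∀ i, Fin (n i) → N i,
      ∀ z i j, Φ z i j = E i (z ⟨i, j⟩) :=
  ⟨{ toFun := fun z i j => E i (z ⟨i, j⟩)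
     invFun := fun z x => (E x.1).symm (z x.1 x.2)
     map_add' := fun _ _ => funext₂ fun i _ => (E i).map_add _ _
     map_smul' := fun a _ => funext₂ fun i _ => (E i).map_smul a _
     left_inv := fun x => funext fun j => (E j.1).symm_apply_apply (x j)
     right_inv := fun x => funext₂ fun i j => (E i).apply_symm_apply (x i j) },
    fun _ _ _ => rfl⟩

namespace ModuleData

theorem coeff_zero_ne_zero (D : ModuleData k) (i : D.ι) : (D.f i).coeff 0 ≠ 0 := by
  obtain ⟨σ, hσ⟩ := D.selfdual
  intro h
  refine (D.monic (σ i)).ne_zero ?_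
  rw [(hσ i).1, starPoly, h, inv_zero, C_0, zero_mul]

theorem starPoly_of_isIdx0 {D : ModuleData k} {i : D.ι} (hi : D.IsIdx0 i) :
    starPoly (D.f i) = D.f i := by
  have hX : (X : k[X]).reverse = 1 := by
    simpa [← C_1, -map_one] using reverse_mul_X (C (1 : k))
  obtain h | h := hi <;> rw [h]
  · have : (X - 1 : k[X]).reverse = 1 - X := by
      simpa [sub_eq_add_neg, hX, add_comm] using reverse_add_C (X : k[X]) (-1)
    simp [starPoly, this]
  · have : (X + 1 : k[X]).reverse = 1 + X := by
      simpa [hX] using reverse_add_C (X : k[X]) 1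
    rw [starPoly, this]
    simp [add_comm]

/-- The self-duality of a module can be realised by an involution of its index set that fixes
the summands of type 0. -/
theorem exists_involutive (D : ModuleData k) : ∃ τ : D.ι → D.ι, Function.Involutive τ ∧
    ∀ i, D.f (τ i) = starPoly (D.f i) ∧ D.n (τ i) = D.n i ∧ (D.IsIdx0 i → τ i = i) := by
  classical
  obtain ⟨σ, hσ⟩ := D.selfdual
  obtain ⟨_, -⟩ := exists_wellFoundedLT k[X]
  have hss (i : D.ι) : starPoly (starPoly (D.f i)) = D.f i :=
    starPoly_starPoly (D.monic i) (D.coeff_zero_ne_zero i)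
  have hσ' (i : D.ι) : D.f (σ.symm i) = starPoly (D.f i) ∧ D.n (σ.symm i) = D.n i := by
    have h := hσ (σ.symm i)
    rw [σ.apply_symm_apply] at h
    exact ⟨by rw [h.1, hss], h.2.2.symm⟩
  let τ (i : D.ι) : D.ι :=
    if D.f i < starPoly (D.f i) then σ i
    else if starPoly (D.f i) < D.f i then σ.symm i else i
  have hlt {i} (h : D.f i < starPoly (D.f i)) : τ i = σ i := if_pos h
  have hgt {i} (h : starPoly (D.f i) < D.f i) : τ i = σ.symm i :=
    (if_neg h.not_gt).trans (if_pos h)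
  have heq {i} (h : starPoly (D.f i) = D.f i) : τ i = i :=
    (if_neg h.not_gt).trans (if_neg h.not_lt)
  refine ⟨τ, fun i => ?_, fun i => ⟨?_, ?_, fun hi => heq (starPoly_of_isIdx0 hi)⟩⟩
  · rcases lt_trichotomy (D.f i) (starPoly (D.f i)) with h | h | h
    · rw [hlt h, hgt (by rwa [(hσ i).1, hss]), σ.symm_apply_apply]
    · rw [heq h.symm, heq h.symm]
    · rw [hgt h, hlt (by rwa [(hσ' i).1, hss]), σ.apply_symm_apply]
  · rcases lt_trichotomy (D.f i) (starPoly (D.f i)) with h | h | h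
    · rw [hlt h, (hσ i).1]
    · rw [heq h.symm, ← h]
    · rw [hgt h, (hσ' i).1]
  · rcases lt_trichotomy (D.f i) (starPoly (D.f i)) with h | h | h
    · rw [hlt h, (hσ i).2.2]
    · rw [heq h.symm]
    · rw [hgt h, (hσ' i).2]

theorem card_eq_dim0 (D : ModuleData k) (hss : D.Semisimple)
    [Fintype {j : Σ i, Fin (D.n i) // D.f j.1 = X - 1 ∨ D.f j.1 = X + 1}] :
    Fintype.card {j : Σ i, Fin (D.n i) // D.f j.1 = X - 1 ∨ D.f j.1 = X + 1} = D.dim0 := by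
  classical
  rw [Fintype.card_subtype, Finset.card_filter, Fintype.sum_sigma, dim0]
  refine Finset.sum_congr rfl fun i _ => ?_
  by_cases hi : D.IsIdx0 i
  · have hi' : D.f i = X - 1 ∨ D.f i = X + 1 := hi
    have hdeg : (D.f i).natDegree = 1 := by
      obtain h | h := hi' <;> rw [h]
      · exact natDegree_X_sub_C 1
      · exact natDegree_X_add_C 1
    simp [hi, hi', hss i, hdeg]
  · have hi' : ¬ (D.f i = X - 1 ∨ D.f i = X + 1) := hi
    simp only [hi, hi', if_false, Finset.sum_const_zero]

/-- A semi-simple module as a direct sum of simple modules `k[X]/(f)`. -/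
theorem exists_equiv_spaceVia (D : ModuleData k) (hss : D.Semisimple) :
    ∃ Φ : (∀ j : Σ i, Fin (D.n i), AdjoinRoot (D.f j.1)) ≃ₗ[k] D.SpaceVia (RingHom.id k),
      ∀ z, Φ (fun j => AdjoinRoot.root _ * z j) = (X : k[X]) • Φ z := by
  have hE (f g : k[X]) (h : f = g) : ∃ E : AdjoinRoot f ≃ₗ[k] (k[X] ⧸ Ideal.span {g}),
      ∀ z, E (AdjoinRoot.root f * z) = (X : k[X]) • E z := by
    subst h
    exact ⟨LinearEquiv.refl k (AdjoinRoot f), fun z => rfl⟩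
  choose E hE using fun i => hE (D.f i) ((D.f i).map (RingHom.id k) ^ D.e i)
    (by rw [hss i, pow_one, Polynomial.map_id])
  obtain ⟨Φ, hΦ⟩ := exists_linearEquiv_piSigma D.n E
  refine ⟨Φ, fun z => funext fun i => funext fun j => ?_⟩
  rw [Pi.smul_apply, Pi.smul_apply, hΦ, hΦ]
  exact hE i _

end ModuleData

/-- **Cor. 4.4.** If `u(k) ≤ dim_k M⁰` (every anisotropic quadratic space
over `k` has dimension at most `dim_k M⁰`), then any quadratic space of dimension
`dim_k M` has an isometry with the semi-simple module `M`. -/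
theorem hasIsometryWithModule_of_uInvariant_le
    (hchar : (2 : k) ≠ 0)
    (D : ModuleData k) (hss : D.Semisimple)
    (hu : ∀ (W : Type) [AddCommGroup W] [Module k W] [FiniteDimensional k W]
      (B' : LinearMap.BilinForm k W), (∀ x y, B' x y = B' y x) →
      (∀ w, B' w w = 0 → w = 0) → Module.finrank k W ≤ D.dim0)
    {V : Type} [AddCommGroup V] [Module k V] [FiniteDimensional k V]
    (B : LinearMap.BilinForm k V) (hq : IsQuadraticSpace B)
    (hdim : Module.finrank k V = D.dim) :
    HasIsometryWithModule B D := by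
  classical
  obtain ⟨τ, hτ, hτD⟩ := D.exists_involutive
  have hJ (i : D.ι) (j : Fin (D.n i)) (i' : D.ι) (h : i' = i) (h' : D.n i = D.n i') :
      (⟨i', Fin.cast h' j⟩ : Σ i, Fin (D.n i)) = ⟨i, j⟩ := by
    subst h
    rfl
  obtain ⟨t, ht, φ, hφ⟩ := exists_isometry_pi_adjoinRoot hchar
    (fun j : Σ i, Fin (D.n i) => D.f j.1) (fun j => D.irr j.1)
    (fun j => D.coeff_zero_ne_zero j.1)
    (τ := fun j => ⟨τ j.1, Fin.cast (hτD j.1).2.1.symm j.2⟩)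
    (fun j => hJ _ _ _ (hτ j.1) ((hτD _).2.1.trans (hτD _).2.1).symm) (fun j => (hτD j.1).1)
    (fun j hj => hJ _ _ _ ((hτD j.1).2.2 hj) (hτD _).2.1.symm) (by rwa [D.card_eq_dim0 hss]) hq
    (by simp [hdim, ModuleData.dim, Fintype.sum_sigma, hss _])
  obtain ⟨Φ, hΦ⟩ := D.exists_equiv_spaceVia hss
  refine ⟨t, ht, φ.trans Φ, fun w => ?_⟩
  rw [LinearEquiv.trans_apply, LinearEquiv.trans_apply, ← hΦ]
  exact congrArg Φ (funext fun j => hφ w j)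

end
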